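/- Let G be a finite simple graph of order n, and let a, b, m, Δ be non-negative integers with b − Δ ≥ a ≥ 2, δ(G) ≥ b(b−Δ)/(a+Δ) + m, and n > (a+b)(a+b+2m−1)/(a+Δ). Let g, f be integer-valued functions on V(G) with a ≤ g(x) ≤ f(x) − Δ ≤ b − Δ for every vertex x. If for every pair of distinct non-adjacent vertices x, y of G we have max{d_G(x), d_G(y)} ≥ (b−Δ)n/(a+b), then G is a fractional (g,f,m)-deleted graph. -/

import Mathlib

open Classical Finset

/-- The fractional degree `d_G^h(x)` of a vertex: the sum of `h e` over all edges
(unordered pairs) containing `x`. -/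
noncomputable def fracDeg {V : Type*} [Fintype V] [DecidableEq V]
    (h : Sym2 V → ℝ) (x : V) : ℝ :=
  ∑ e ∈ Finset.univ.filter (fun e : Sym2 V => x ∈ e), h e

/-- `G` admits a fractional `(g,f)`-factor: a weighting `h : E(G) → [0,1]`
(extended by `0` off the edge set) with `g x ≤ d_G^h(x) ≤ f x` for every vertex. -/
def HasFracFactor {V : Type*} [Fintype V] [DecidableEq V]
    (G : SimpleGraph V) (g f : V → ℤ) : Prop :=
  ∃ h : Sym2 V → ℝ,
    (∀ e, 0 ≤ h e ∧ h e ≤ 1) ∧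
    (∀ e, e ∉ G.edgeSet → h e = 0) ∧
    (∀ x : V, (g x : ℝ) ≤ fracDeg h x ∧ fracDeg h x ≤ (f x : ℝ))

/-- `G` is a fractional `(g,f,m)`-deleted graph: after deleting any `m` edges,
the resulting graph admits a fractional `(g,f)`-factor. -/
def FracDeleted {V : Type*} [Fintype V] [DecidableEq V]
    (G : SimpleGraph V) (g f : V → ℤ) (m : ℕ) : Prop :=
  ∀ H : Finset (Sym2 V), ↑H ⊆ G.edgeSet → H.card = m →
    HasFracFactor (G.deleteEdges ↑H) g f

/-- `G` is a fractional `(g,f,n',m)`-critical deleted graph: after deleting any `n'`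
vertices, the resulting induced graph is a fractional `(g,f,m)`-deleted graph. -/
def FracCriticalDeleted {V : Type*} [Fintype V] [DecidableEq V]
    (G : SimpleGraph V) (g f : V → ℤ) (n' m : ℕ) : Prop :=
  ∀ U : Finset V, U.card = n' →
    FracDeleted (G.induce ((↑U : Set V)ᶜ)) (fun x => g x.1) (fun x => f x.1) m

/-- `G` is a fractional ID-`(g,f,m)`-deleted graph: after deleting any independent set
of vertices, the resulting induced graph is a fractional `(g,f,m)`-deleted graph. -/
def FracIDDeleted {V : Type*} [Fintype V] [DecidableEq V]
    (G : SimpleGraph V) (g f : V → ℤ) (m : ℕ) : Prop :=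
  ∀ I : Set V, (∀ u ∈ I, ∀ v ∈ I, ¬ G.Adj u v) →
    FracDeleted (G.induce Iᶜ) (fun x => g x.1) (fun x => f x.1) m

/-- The number of neighbours of `x` outside `S`. -/
noncomputable def degOutside {V : Type*} [Fintype V] (G : SimpleGraph V) (S : Finset V)
    (x : V) : ℕ :=
  #{y | G.Adj x y ∧ y ∉ S}

/-- The fractional degree is a sum over potential neighbours. -/
lemma fracDeg_eq_sum {V : Type*} [Fintype V] [DecidableEq V] (h : Sym2 V → ℝ) (x : V) :
    fracDeg h x = ∑ y, h s(x, y) := by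
  unfold fracDeg
  symm
  refine Finset.sum_bij (fun y _ => s(x, y)) ?_ ?_ ?_ ?_
  · intro y _; simp
  · intro y _ z _ hyz
    exact Sym2.congr_right.mp hyz
  · intro e he
    obtain ⟨y, rfl⟩ := (Finset.mem_filter.mp he).2
    exact ⟨y, Finset.mem_univ _, rfl⟩
  · intro y _; rfl

/-- Splitting off one layer of height `μ` from a potential `c` whose nonzero values all have
absolute value at least `μ`. -/
lemma max_add_eq_layer {μ c d : ℝ} (hμ : 0 < μ) (hc : c = 0 ∨ μ ≤ |c|) (hd : d = 0 ∨ μ ≤ |d|) :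
    max (c + d) 0 = μ * max (SignType.sign c + SignType.sign d : ℝ) 0 +
      max ((c - μ * SignType.sign c) + (d - μ * SignType.sign d)) 0 := by
  have key : ∀ z : ℝ, (z = 0 ∨ μ ≤ |z|) →
      (z = 0 ∧ (SignType.sign z : ℝ) = 0) ∨ (μ ≤ z ∧ (SignType.sign z : ℝ) = 1) ∨
        (z ≤ -μ ∧ (SignType.sign z : ℝ) = -1) := by
    intro z hz
    rcases lt_trichotomy z 0 with h | h | h
    · right; right
      rw [abs_of_neg h] at hz
      refine ⟨?_, by simp [sign_neg h]⟩
      rcases hz with hz | hz <;> linarith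
    · left; simp [h]
    · right; left
      rw [abs_of_pos h] at hz
      refine ⟨?_, by simp [sign_pos h]⟩
      rcases hz with hz | hz <;> linarith
  rcases key c hc with ⟨h1, e1⟩ | ⟨h1, e1⟩ | ⟨h1, e1⟩ <;>
  rcases key d hd with ⟨h2, e2⟩ | ⟨h2, e2⟩ | ⟨h2, e2⟩ <;>
  rw [e1, e2] <;> norm_num <;>
  (try simp only [max_def]) <;> split_ifs <;> linarith

/-- The cut condition for sets implies the cut inequality for real potentials. -/
lemma potential_inequality {V : Type*} [Fintype V] [DecidableEq V] (G : SimpleGraph V)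
    (g f : V → ℤ)
    (hcut : ∀ S T : Finset V, Disjoint S T → ∑ x ∈ T, g x ≤
      ∑ x ∈ S, f x + ∑ x ∈ T, (degOutside G S x : ℤ)) (c : V → ℝ) :
    2 * ∑ x, (max (c x) 0 * g x - max (-c x) 0 * f x) ≤
      ∑ x, ∑ y, if G.Adj x y then max (c x + c y) 0 else 0 := by
  have hsign : ∀ c : V → ℝ, 2 * ∑ x, (max (SignType.sign (c x) : ℝ) 0 * g x -
      max (-(SignType.sign (c x) : ℝ)) 0 * f x) ≤
      ∑ x, ∑ y, if G.Adj x y then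
        max ((SignType.sign (c x) : ℝ) + (SignType.sign (c y) : ℝ)) 0 else 0 := by
    intro c
    have h := hcut {x | c x < 0} {x | 0 < c x} (by
      rw [Finset.disjoint_filter]; intro x _ h; exact not_lt.mpr h.le)
    have h' : ∑ x, (if 0 < c x then (g x : ℝ) else 0) ≤
        ∑ x, (if c x < 0 then (f x : ℝ) else 0) +
        ∑ x, (if 0 < c x then ∑ y, (if G.Adj x y ∧ ¬ c y < 0 then (1 : ℝ) else 0) else 0) := by
      rw [← Finset.sum_filter, ← Finset.sum_filter, ← Finset.sum_filter]
      have : ((∑ x with 0 < c x, g x : ℤ) : ℝ) ≤ ((∑ x with c x < 0, f x +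
          ∑ x with 0 < c x, (#{y | G.Adj x y ∧ ¬ c y < 0} : ℤ) : ℤ) : ℝ) := by
        refine Int.cast_le.mpr (h.trans_eq ?_)
        simp [degOutside]
      push_cast at this
      simpa using this
    have e1 : ∑ x, (max (SignType.sign (c x) : ℝ) 0 * g x -
        max (-(SignType.sign (c x) : ℝ)) 0 * f x) =
        ∑ x, (if 0 < c x then (g x : ℝ) else 0) - ∑ x, (if c x < 0 then (f x : ℝ) else 0) := by
      rw [← Finset.sum_sub_distrib]
      refine Finset.sum_congr rfl fun x _ => ?_
      rcases lt_trichotomy (c x) 0 with h | h | h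
      · simp [sign_neg h, h, not_lt.mpr h.le]
      · simp [h]
      · simp [sign_pos h, h, not_lt.mpr h.le]
    set A : V → V → ℝ := fun x y => if 0 < c x then (if G.Adj x y ∧ ¬ c y < 0 then 1 else 0) else 0
      with hA
    have e2 : ∑ x, ∑ y, (if G.Adj x y then
        max ((SignType.sign (c x) : ℝ) + (SignType.sign (c y) : ℝ)) 0 else 0) =
        ∑ x, ∑ y, A x y + ∑ x, ∑ y, A y x := by
      simp_rw [← Finset.sum_add_distrib]
      refine Finset.sum_congr rfl fun x _ => Finset.sum_congr rfl fun y _ => ?_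
      simp only [hA, G.adj_comm y x]
      by_cases hxy : G.Adj x y
      · rcases lt_trichotomy (c x) 0 with h | h | h <;>
        rcases lt_trichotomy (c y) 0 with h2 | h2 | h2 <;>
        (try rw [h]) <;> (try rw [h2]) <;>
        simp [hxy, sign_neg, sign_pos, h, h2, not_lt.mpr, h.le, h2.le]
      · simp [hxy]
    have e3 : ∑ x, ∑ y, A y x = ∑ x, ∑ y, A x y := Finset.sum_comm
    have e4 : ∑ x, ∑ y, A x y =
        ∑ x, (if 0 < c x then ∑ y, (if G.Adj x y ∧ ¬ c y < 0 then (1 : ℝ) else 0) else 0) := by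
      refine Finset.sum_congr rfl fun x _ => ?_
      by_cases hx : 0 < c x <;> simp [hA, hx]
    rw [e1, e2, e3, e4]
    linarith
  induction hN : #{x | c x ≠ 0} using Nat.strong_induction_on generalizing c with
  | _ N ih =>
    by_cases hne : ({x | c x ≠ 0} : Finset V).Nonempty
    · obtain ⟨z, hz, hmin⟩ := Finset.exists_min_image _ (fun x => |c x|) hne
      have hz0 : c z ≠ 0 := by simpa using hz
      set μ := |c z| with hμ
      have hμ0 : 0 < μ := abs_pos.mpr hz0
      have hc : ∀ x, c x = 0 ∨ μ ≤ |c x| := by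
        intro x
        by_cases hx : c x = 0
        · exact Or.inl hx
        · exact Or.inr (hmin x (by simpa using hx))
      set c' : V → ℝ := fun x => c x - μ * SignType.sign (c x) with hc'
      have hlt : #{x | c' x ≠ 0} < N := by
        rw [← hN]
        refine Finset.card_lt_card ⟨?_, fun hsub => ?_⟩
        · intro x
          simp only [Finset.mem_filter, Finset.mem_univ, true_and]
          intro hx h0
          exact hx (by simp [hc', h0])
        · have := hsub hz
          simp only [Finset.mem_filter, Finset.mem_univ, true_and, hc', hμ] at this
          exact this (by rw [abs_mul_sign, sub_self])
      have h1 := ih _ hlt c' rfl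
      have h2 := mul_le_mul_of_nonneg_left (hsign c) hμ0.le
      have hone : ∀ x, max (c x) 0 = μ * max (SignType.sign (c x) : ℝ) 0 + max (c' x) 0 := by
        intro x
        simpa using max_add_eq_layer hμ0 (hc x) (Or.inl rfl : (0 : ℝ) = 0 ∨ _)
      have hneg : ∀ x, max (-c x) 0 = μ * max (-(SignType.sign (c x) : ℝ)) 0 + max (-c' x) 0 := by
        intro x
        have := max_add_eq_layer (c := -c x) (d := 0) hμ0 (by simpa using hc x) (Or.inl rfl)
        simp only [Left.sign_neg, sign_zero, SignType.coe_neg, SignType.coe_zero, add_zero,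
          mul_zero, sub_zero] at this
        rw [this, hc']
        ring_nf
      have e1 : 2 * ∑ x, (max (c x) 0 * g x - max (-c x) 0 * f x) =
          μ * (2 * ∑ x, (max (SignType.sign (c x) : ℝ) 0 * g x -
            max (-(SignType.sign (c x) : ℝ)) 0 * f x)) +
          2 * ∑ x, (max (c' x) 0 * g x - max (-c' x) 0 * f x) := by
        simp only [Finset.mul_sum, ← Finset.sum_add_distrib]
        refine Finset.sum_congr rfl fun x _ => ?_
        rw [hone, hneg]; ring
      have e2 : ∑ x, ∑ y, (if G.Adj x y then max (c x + c y) 0 else 0) =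
          μ * (∑ x, ∑ y, if G.Adj x y then
            max ((SignType.sign (c x) : ℝ) + (SignType.sign (c y) : ℝ)) 0 else 0) +
          ∑ x, ∑ y, if G.Adj x y then max (c' x + c' y) 0 else 0 := by
        simp only [Finset.mul_sum, ← Finset.sum_add_distrib]
        refine Finset.sum_congr rfl fun x _ => Finset.sum_congr rfl fun y _ => ?_
        by_cases hxy : G.Adj x y
        · simpa only [hxy, if_true] using max_add_eq_layer hμ0 (hc x) (hc y)
        · simp [hxy]
      rw [e1, e2]
      exact add_le_add h2 h1
    · have h0 : ∀ x, c x = 0 := by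
        intro x
        by_contra hx
        exact hne ⟨x, by simpa using hx⟩
      simp [h0]

/-- The sufficiency half of the fractional `(g,f)`-factor theorem. -/
theorem hasFracFactor_of_cut {V : Type*} [Fintype V] [DecidableEq V] (G : SimpleGraph V)
    (g f : V → ℤ) (hgf : ∀ x, g x ≤ f x)
    (hcut : ∀ S T : Finset V, Disjoint S T → ∑ x ∈ T, g x ≤
      ∑ x ∈ S, f x + ∑ x ∈ T, (degOutside G S x : ℤ)) :
    HasFracFactor G g f := by
  set P : Set (Sym2 V → ℝ) :=
    Set.pi Set.univ fun e => if e ∈ G.edgeSet then Set.Icc 0 1 else {0} with hP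
  have hPcomp : IsCompact P := isCompact_univ_pi fun e => by
    split_ifs
    exacts [isCompact_Icc, isCompact_singleton]
  have hPconv : Convex ℝ P := convex_pi fun e _ => by
    split_ifs
    exacts [convex_Icc 0 1, convex_singleton 0]
  let L : (Sym2 V → ℝ) →ₗ[ℝ] (V → ℝ) :=
    { toFun := fun h x => fracDeg h x
      map_add' := fun h h' => by
        ext x; simp [fracDeg, Finset.sum_add_distrib]
      map_smul' := fun r h => by
        ext x; simp [fracDeg, Finset.mul_sum] }
  have hL : Continuous L := L.continuous_of_finiteDimensional
  set B : Set (V → ℝ) := Set.Icc (fun x => (g x : ℝ)) (fun x => (f x : ℝ))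
  by_contra hno
  have hdisj : Disjoint (L '' P) B := by
    rw [Set.disjoint_left]
    rintro _ ⟨h, hh, rfl⟩ hb
    refine hno ⟨h, fun e => ?_, fun e he => ?_, fun x => ⟨hb.1 x, hb.2 x⟩⟩
    · have := hh e (Set.mem_univ e)
      by_cases he : e ∈ G.edgeSet
      · simpa [he] using this
      · have h0 : h e = 0 := by simpa [he] using this
        rw [h0]; norm_num
    · have := hh e (Set.mem_univ e)
      simpa [he] using this
  obtain ⟨φ, u, v, h1, h2, h3⟩ := geometric_hahn_banach_compact_closed
    (hPconv.linear_image L) (hPcomp.image hL) (convex_Icc _ _) isClosed_Icc hdisj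
  set c : V → ℝ := fun x => φ (Pi.single x 1)
  have hφ : ∀ d : V → ℝ, φ d = ∑ x, d x * c x := by
    intro d
    conv_lhs => rw [pi_eq_sum_univ' d]
    rw [map_sum]
    refine Finset.sum_congr rfl fun x _ => ?_
    rw [map_smul, smul_eq_mul]
  let σ : Sym2 V → ℝ := Sym2.lift ⟨fun x y => c x + c y, fun x y => add_comm _ _⟩
  set h : Sym2 V → ℝ := fun e => if e ∈ G.edgeSet ∧ 0 < σ e then 1 else 0 with hh
  have hhP : h ∈ P := by
    intro e _
    by_cases he : e ∈ G.edgeSet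
    · by_cases hs : 0 < σ e <;> simp [hh, he, hs]
    · simp [hh, he]
  have hlow := h1 _ ⟨h, hhP, rfl⟩
  have hup := h3 (fun x => if 0 < c x then (g x : ℝ) else f x) (by
    have hgf' : ∀ x, (g x : ℝ) ≤ f x := fun x => by exact_mod_cast hgf x
    constructor <;> intro x <;> by_cases hx : 0 < c x <;> simp [hx, hgf'])
  rw [hφ] at hlow hup
  have e1 : ∑ x, (if 0 < c x then (g x : ℝ) else f x) * c x =
      ∑ x, (max (c x) 0 * g x - max (-c x) 0 * f x) := by
    refine Finset.sum_congr rfl fun x _ => ?_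
    by_cases hx : 0 < c x
    · simp [hx, hx.le, mul_comm]
    · simp [hx, not_lt.mp hx, mul_comm]
  have e2 : 2 * ∑ x, L h x * c x = ∑ x, ∑ y, if G.Adj x y then max (c x + c y) 0 else 0 := by
    have hLx : ∀ x, L h x = ∑ y, h s(x, y) := fun x => fracDeg_eq_sum h x
    have e3 : ∑ x, L h x * c x = ∑ x, ∑ y, h s(x, y) * c x := by
      simp_rw [hLx, Finset.sum_mul]
    have e4 : ∑ x, ∑ y, h s(x, y) * c x = ∑ x, ∑ y, h s(x, y) * c y := by
      rw [Finset.sum_comm]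
      refine Finset.sum_congr rfl fun x _ => Finset.sum_congr rfl fun y _ => ?_
      rw [Sym2.eq_swap]
    rw [two_mul]
    conv_lhs => rw [e3]
    conv_lhs => enter [2]; rw [e4]
    simp_rw [← Finset.sum_add_distrib]
    refine Finset.sum_congr rfl fun x _ => Finset.sum_congr rfl fun y _ => ?_
    have hσ : σ s(x, y) = c x + c y := rfl
    by_cases hxy : G.Adj x y
    · by_cases hs : 0 < c x + c y
      · simp [hh, hxy, hσ, hs, hs.le]
      · simp [hh, hxy, hσ, hs, not_lt.mp hs]
    · simp [hh, hxy]
  have := potential_inequality G g f hcut c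
  rw [e1] at hup
  linarith

/-- The numerical core: parameters of a violated cut cannot satisfy the degree and order bounds.
Here `s = |S|`, the set `T` splits into a clique of size `w` and `τ` vertices of large degree,
`D` and `M` are the degree sums over `T` in the remaining graph and among deleted edges. -/
lemma no_violating_parameters {a b m Δ s w τ r : ℕ} {D M k : ℝ} {n : ℝ}
    (hba : a + Δ ≤ b) (ha : 2 ≤ a) (hn0 : n = s + (w + τ) + r)
    (hn : n * ((a : ℝ) + Δ) > ((a : ℝ) + b) * ((a : ℝ) + b + 2 * m - 1))
    (hk : ((a : ℝ) + b) * k = ((b : ℝ) - Δ) * n - (a + b) * s)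
    (hcut : ((a : ℝ) + Δ) * s + D + 1 ≤ ((b : ℝ) - Δ) * (w + τ))
    (hD0 : 0 ≤ D) (hM : M ≤ 2 * m)
    (hD : D ≤ ((b : ℝ) - Δ - 1) * (w + τ))
    (hδ : (w + τ) * ((b : ℝ) * (b - Δ)) ≤ ((a : ℝ) + Δ) * (D + (w + τ) * s))
    (hδM : (w + τ) * ((b : ℝ) * (b - Δ) + (a + Δ) * m) ≤
      ((a : ℝ) + Δ) * (D + M + (w + τ) * s))
    (hW : τ * k + w * ((w : ℝ) - 1) ≤ D + M)
    (hW1 : 0 < k → τ + w * ((w : ℝ) - 1) ≤ D + M)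
    (hZ : τ * (k - (b - Δ) + 1) ≤ M) : False := by
  obtain ⟨p, rfl⟩ : ∃ p, b = p + Δ := ⟨b - Δ, by omega⟩
  obtain ⟨q, hq⟩ : ∃ q, q = a + Δ := ⟨_, rfl⟩
  have hqR : (q : ℝ) = a + Δ := by rw [hq]; push_cast; ring
  have hp2 : (2 : ℝ) ≤ p := by exact_mod_cast (by omega : 2 ≤ p)
  have hq2 : (2 : ℝ) ≤ q := by exact_mod_cast (by omega : 2 ≤ q)
  obtain ⟨b, hb⟩ : ∃ b, b = p + Δ := ⟨_, rfl⟩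
  have hbR : (b : ℝ) = p + Δ := by rw [hb]; push_cast; ring
  have hqb : (q : ℝ) ≤ b := by exact_mod_cast (by omega : q ≤ b)
  have hab : (a : ℝ) + (p + Δ) = p + q := by rw [hqR]; ring
  have hpb : (p : ℝ) + Δ - Δ = p := by ring
  push_cast at *
  rw [hab] at hn hk
  rw [hpb] at hk hcut hD hδ hδM hZ
  rw [← hbR] at hδ hδM
  rw [← hqR] at hn hcut hδ hδM
  obtain ⟨t, ht⟩ : ∃ t, t = w + τ := ⟨_, rfl⟩
  have htR : (t : ℝ) = w + τ := by rw [ht]; push_cast; ring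
  rw [← htR] at hcut hD hδ hδM hn0
  have ht0 : (0 : ℝ) ≤ t := by positivity
  have htpos : (0 : ℝ) < t := by
    have : (0 : ℝ) < p * t := lt_of_lt_of_le (by positivity) hcut
    exact pos_of_mul_pos_right this (by linarith)
  have htb : (b : ℝ) < t := by
    by_contra hle
    push Not at hle
    have h1 : (t : ℝ) * (q * s + D + 1) ≤ t * (p * t) := mul_le_mul_of_nonneg_left hcut ht0
    rcases le_total (q : ℝ) t with h | h
    · linarith [mul_nonneg (sub_nonneg.mpr h) hD0,
        mul_nonneg (mul_nonneg ht0 (by linarith : (0 : ℝ) ≤ p)) (sub_nonneg.mpr hle)]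
    · linarith [mul_le_mul_of_nonneg_left hD (sub_nonneg.mpr h),
        mul_nonneg (mul_nonneg ht0 (by linarith : (0 : ℝ) ≤ p)) (sub_nonneg.mpr hqb),
        mul_nonneg ht0 (sub_nonneg.mpr h)]
  have hr0 : (0 : ℝ) ≤ r := by positivity
  have hw0 : (0 : ℝ) ≤ w := by positivity
  have hτ0 : (0 : ℝ) ≤ τ := by positivity
  have hm0 : (0 : ℝ) ≤ m := by positivity
  have hpq : (0 : ℝ) < p + q := by linarith
  have hDk : D + p * r + 1 ≤ (p + q) * k := by rw [hk, hn0]; linarith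
  have hk0 : 0 < k := by
    have : (0 : ℝ) < (p + q) * k := lt_of_lt_of_le (by positivity) hDk
    exact pos_of_mul_pos_right this hpq.le
  have htbig : (p : ℝ) + q + 2 * m - 1 + k - r < t := by
    have : (p + q : ℝ) * (p + q + 2 * m - 1 + k - r) < (p + q) * t := by
      have : (p + q : ℝ) * k = p * (s + t + r) - (p + q) * s := by rw [hk, hn0]
      rw [hn0] at hn
      linarith
    exact lt_of_mul_lt_mul_left this hpq.le
  rcases le_total k 1 with hk1 | hk1
  · have := hW1 hk0
    linarith [sq_nonneg ((w : ℝ) - 1), mul_nonneg (by linarith : (0 : ℝ) ≤ p + q - 1)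
      (sub_nonneg.mpr hk1), mul_nonneg (by linarith : (0 : ℝ) ≤ p - 1) hr0]
  rcases le_or_gt k p with hkp | hkp
  · have h1 : k * (p + q + 2 * m - 1 + k - r) < k * t := mul_lt_mul_of_pos_left htbig hk0
    have h2 : τ * k = k * t - k * w := by rw [htR]; ring
    linarith [sq_nonneg ((w : ℝ) - (k + 1) / 2), mul_nonneg hr0 (sub_nonneg.mpr hkp),
      mul_nonneg hm0 (sub_nonneg.mpr hk1), sq_nonneg (k - 1)]
  have hX : τ * k + w * ((w : ℝ) - 1) < p * t := by
    have h1 : (t : ℝ) * (q * s + D + 1) ≤ t * (p * t) := mul_le_mul_of_nonneg_left hcut ht0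
    have h2 : ((t : ℝ) - q) * (τ * k + w * ((w : ℝ) - 1)) < t * p * (t - b) := by
      have h3 := mul_le_mul_of_nonneg_left hW (by linarith : (0 : ℝ) ≤ t - q)
      have h4 : (0 : ℝ) ≤ t * (q * m - M) := mul_nonneg ht0 (by
        linarith [mul_le_mul_of_nonneg_right hq2 hm0])
      linarith
    have h5 : (t : ℝ) * p * (t - b) ≤ (t - q) * (p * t) := by
      linarith [mul_nonneg (mul_nonneg ht0 (by linarith : (0 : ℝ) ≤ p)) (sub_nonneg.mpr hqb)]
    exact lt_of_mul_lt_mul_left (h2.trans_le h5) (by linarith)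
  have hwp : w ≤ p := by
    by_contra h
    push Not at h
    have h' : (p : ℝ) + 1 ≤ w := by exact_mod_cast h
    rw [htR] at hX
    linarith [mul_nonneg hτ0 (sub_nonneg.mpr hkp.le), mul_nonneg hw0 (sub_nonneg.mpr h')]
  have htb' : b < t := by exact_mod_cast htb
  have hpτ : (q : ℝ) ≤ p * τ := by
    have h1 : Δ + 1 ≤ τ := by omega
    have h2 : p * (Δ + 1) ≤ p * τ := Nat.mul_le_mul_left p h1
    have h3 : q ≤ p * τ := by nlinarith
    exact_mod_cast h3
  have h2m : (p : ℝ) * t > p * (p + q - 1) + p * (2 * m) - q * k + 1 + D := by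
    linarith [mul_lt_mul_of_pos_left htbig (by linarith : (0 : ℝ) < p)]
  have hkpτ := mul_nonneg (sub_nonneg.mpr hpτ) (sub_nonneg.mpr hkp.le)
  have hwp' : w = p := by
    have h1 : (p : ℝ) * (τ * (k - p + 1)) ≤ p * (2 * m) :=
      mul_le_mul_of_nonneg_left (hZ.trans hM) (by linarith)
    have h2 : (p : ℝ) * (p - 1) < p * w := by
      rw [htR] at h2m
      linarith
    have h3 : (p : ℝ) - 1 < w := lt_of_mul_lt_mul_left h2 (by linarith)
    have h4 : (p : ℝ) < w + 1 := by linarith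
    have h5 : p < w + 1 := by exact_mod_cast h4
    omega
  have h1 : (p : ℝ) * (τ * k + w * ((w : ℝ) - 1) - D) ≤ p * (2 * m) :=
    mul_le_mul_of_nonneg_left (by linarith) (by linarith)
  have hwR : (w : ℝ) = p := by rw [hwp']
  have h2 := mul_le_mul_of_nonneg_left hD (by linarith : (0 : ℝ) ≤ p - 1)
  rw [htR, hwR] at h2m h2
  rw [hwR] at h1
  linarith [mul_nonneg hτ0 (by linarith : (0 : ℝ) ≤ p - 1), sq_nonneg ((p : ℝ) - 1)]

/-- Every set of edges has degree sum at most twice its size. -/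
lemma sum_incident_card_le {V : Type*} [Fintype V] [DecidableEq V] (H : Finset (Sym2 V))
    (T : Finset V) : ∑ x ∈ T, #{e ∈ H | x ∈ e} ≤ 2 * #H := by
  calc ∑ x ∈ T, #{e ∈ H | x ∈ e} = ∑ e ∈ H, #{x ∈ T | x ∈ e} :=
        Finset.sum_card_bipartiteAbove_eq_sum_card_bipartiteBelow (fun x e => x ∈ e)
    _ ≤ ∑ e ∈ H, 2 := by
        refine Finset.sum_le_sum fun e _ => ?_
        induction e with
        | _ u v =>
          refine (Finset.card_le_card (t := {u, v}) fun x hx => ?_).trans Finset.card_le_two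
          simpa using (Finset.mem_filter.mp hx).2
    _ = 2 * #H := by simp [mul_comm]

/-- Neighbours of `x` outside `S` are either neighbours after deleting `H`, or joined to `x`
by an edge of `H`. -/
lemma card_neighbors_le {V : Type*} [Fintype V] [DecidableEq V] (G : SimpleGraph V)
    (H : Finset (Sym2 V)) (S : Finset V) (x : V) :
    degOutside G S x ≤ degOutside (G.deleteEdges ↑H) S x + #{e ∈ H | x ∈ e} := by
  have h1 : #{y | s(x, y) ∈ H} ≤ #{e ∈ H | x ∈ e} := by
    refine Finset.card_le_card_of_injOn (fun y => s(x, y)) ?_ ?_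
    · intro y hy
      simpa using hy
    · intro y _ z _ hyz
      exact Sym2.congr_right.mp hyz
  refine le_trans ?_ (Nat.add_le_add_left h1 _)
  refine le_trans (Finset.card_le_card ?_) (Finset.card_union_le _ _)
  intro y hy
  simp only [Finset.mem_filter, Finset.mem_univ, true_and, Finset.mem_union, SimpleGraph.deleteEdges_adj,
    Finset.mem_coe] at hy ⊢
  tauto

lemma card_le_degOutside {V : Type*} [Fintype V] {G : SimpleGraph V} {S A : Finset V} {x : V}
    (h : ∀ y ∈ A, G.Adj x y ∧ y ∉ S) : #A ≤ degOutside G S x :=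
  Finset.card_le_card fun y hy => Finset.mem_filter.mpr ⟨Finset.mem_univ y, h y hy⟩

theorem statement_14 {V : Type*} [Fintype V] [DecidableEq V]
    (G : SimpleGraph V) [DecidableRel G.Adj] (a b m Δ : ℕ) (g f : V → ℤ)
    (hba : a + Δ ≤ b) (ha : 2 ≤ a)
    (hmin : ∀ v : V, (G.degree v : ℝ) ≥
      (b : ℝ) * ((b : ℝ) - Δ) / ((a : ℝ) + Δ) + m)
    (hn : (Fintype.card V : ℝ) >
      ((a : ℝ) + b) * ((a : ℝ) + b + 2 * m - 1) / ((a : ℝ) + Δ))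
    (hgf : ∀ x : V, (a : ℤ) ≤ g x ∧ g x ≤ f x - (Δ : ℤ) ∧ f x - (Δ : ℤ) ≤ (b : ℤ) - (Δ : ℤ))
    (hdeg : ∀ x y : V, x ≠ y → ¬ G.Adj x y →
      ((max (G.degree x) (G.degree y) : ℕ) : ℝ) ≥
        ((b : ℝ) - Δ) * Fintype.card V / ((a : ℝ) + b)) :
    FracDeleted G g f m := by
  intro H hH hHm
  refine hasFracFactor_of_cut _ g f (fun x => by have := hgf x; omega) ?_
  by_contra hcon
  push Not at hcon
  obtain ⟨S, T₀, hST₀, hlt₀⟩ := hcon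
  set d : V → ℕ := degOutside (G.deleteEdges ↑H) S
  set ε : V → ℕ := fun x => #{e ∈ H | x ∈ e}
  set T : Finset V := {x | x ∉ S ∧ (d x : ℤ) < g x} with hT
  have hlt : ∑ x ∈ S, f x + ∑ x ∈ T, (d x : ℤ) < ∑ x ∈ T, g x := by
    have h1 : ∑ x ∈ T₀, (g x - d x) ≤ ∑ x ∈ T, (g x - d x) := by
      calc ∑ x ∈ T₀, (g x - d x) ≤ ∑ x ∈ T₀ ∩ T, (g x - d x) := by
            rw [← Finset.sum_inter_add_sum_sdiff T₀ T]
            have : ∑ x ∈ T₀ \ T, (g x - (d x : ℤ)) ≤ 0 := Finset.sum_nonpos fun x hx => by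
              rw [Finset.mem_sdiff] at hx
              have hxS : x ∉ S := fun h => Finset.disjoint_left.mp hST₀ h hx.1
              have := hx.2
              simp only [hT, Finset.mem_filter, Finset.mem_univ, true_and, hxS, not_false_eq_true,
                not_lt] at this
              linarith
            linarith
        _ ≤ ∑ x ∈ T, (g x - d x) := by
            refine Finset.sum_le_sum_of_subset_of_nonneg Finset.inter_subset_right
              fun x hx _ => ?_
            have := (Finset.mem_filter.mp hx).2.2
            linarith
    rw [Finset.sum_sub_distrib, Finset.sum_sub_distrib] at h1
    linarith only [h1, hlt₀]
  have hdeg_le : ∀ x, G.degree x ≤ d x + ε x + #S := by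
    intro x
    have h1 := card_neighbors_le G H S x
    have h2 : G.degree x ≤ degOutside G S x + #S := by
      rw [← SimpleGraph.card_neighborFinset_eq_degree]
      refine le_trans (Finset.card_le_card fun y hy => ?_) (Finset.card_union_le _ _)
      have : G.Adj x y := by simpa using hy
      by_cases hyS : y ∈ S <;> simp [this, hyS]
    exact h2.trans (Nat.add_le_add_right h1 _)
  have hTd : ∀ x ∈ T, (d x : ℝ) ≤ (b : ℝ) - Δ - 1 := by
    intro x hx
    have h1 := (Finset.mem_filter.mp hx).2.2
    have h2 := hgf x
    have h3 : (d x : ℤ) ≤ (b : ℤ) - Δ - 1 := by omega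
    exact_mod_cast h3
  set K : ℝ := ((b : ℝ) - Δ) * Fintype.card V / ((a : ℝ) + b) with hK
  set W : Finset V := {x ∈ T | (G.degree x : ℝ) < K} with hW
  set Z : Finset V := {x ∈ T | ¬ (G.degree x : ℝ) < K} with hZ
  have ha' : (2 : ℝ) ≤ a := by exact_mod_cast ha
  have hpab : (0 : ℝ) < (a : ℝ) + b := by positivity
  have hpaΔ : (0 : ℝ) < (a : ℝ) + Δ := by positivity
  have hWclique : ∀ x ∈ W, (#W : ℝ) - 1 ≤ d x + ε x := by
    intro x hx
    have h1 : #(W.erase x) ≤ d x + ε x := by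
      refine (card_le_degOutside fun y hy => ?_).trans (card_neighbors_le G H S x)
      rw [Finset.mem_erase] at hy
      have hyT := Finset.mem_filter.mp hy.2
      have hxT := Finset.mem_filter.mp hx
      refine ⟨?_, (Finset.mem_filter.mp hyT.1).2.1⟩
      by_contra hadj
      have h2 := hdeg x y hy.1.symm hadj
      rw [Nat.cast_max] at h2
      exact absurd h2 (not_le.mpr (max_lt hxT.2 hyT.2))
    rw [Finset.card_erase_of_mem hx] at h1
    have h2 : #W ≤ d x + ε x + 1 := by omega
    have h3 : (#W : ℝ) ≤ d x + ε x + 1 := by exact_mod_cast h2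
    linarith
  have hZdeg : ∀ x ∈ Z, K - #S ≤ (d x : ℝ) + ε x := by
    intro x hx
    have h1 := not_lt.mp (Finset.mem_filter.mp hx).2
    have h2 : (G.degree x : ℝ) ≤ d x + ε x + #S := by exact_mod_cast hdeg_le x
    linarith
  have hcardT : (#T : ℝ) = #W + #Z := by
    rw [hW, hZ]
    exact_mod_cast (Finset.card_filter_add_card_filter_not _).symm
  have hsplit : ∀ F : V → ℝ, ∑ x ∈ T, F x = ∑ x ∈ W, F x + ∑ x ∈ Z, F x := fun F =>
    (Finset.sum_filter_add_sum_filter_not T _ F).symm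
  have hST : Disjoint S T := Finset.disjoint_left.mpr fun x hxS hxT =>
    (Finset.mem_filter.mp hxT).2.1 hxS
  have hstn : #S + #T ≤ Fintype.card V := by
    rw [← Finset.card_union_of_disjoint hST]
    exact Finset.card_le_univ _
  have hsumWZ : ∀ c : ℝ, (∀ x ∈ Z, c ≤ (d x : ℝ) + ε x) →
      #Z * c + #W * ((#W : ℝ) - 1) ≤ ∑ x ∈ T, (d x : ℝ) + ∑ x ∈ T, (ε x : ℝ) := by
    intro c hc
    rw [← Finset.sum_add_distrib, hsplit]
    have h1 := Finset.card_nsmul_le_sum W _ _ hWclique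
    have h2 := Finset.card_nsmul_le_sum Z _ _ hc
    rw [nsmul_eq_mul] at h1 h2
    linarith
  have hδx : ∀ x, (b : ℝ) * (b - Δ) + (a + Δ) * m ≤ (a + Δ) * (d x + ε x + #S) := by
    intro x
    have h2 : (G.degree x : ℝ) ≤ d x + ε x + #S := by exact_mod_cast hdeg_le x
    have h3 := mul_le_mul_of_nonneg_left ((hmin x).le.trans h2) hpaΔ.le
    rw [mul_add, mul_div_cancel₀ _ hpaΔ.ne'] at h3
    exact h3
  have hεm : ∀ x, (ε x : ℝ) ≤ m := by
    intro x
    rw [← hHm]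
    exact_mod_cast Finset.card_filter_le _ _
  refine no_violating_parameters (s := #S) (w := #W) (τ := #Z) (m := m)
    (r := Fintype.card V - (#S + #T)) (D := ∑ x ∈ T, (d x : ℝ)) (M := ∑ x ∈ T, (ε x : ℝ))
    (k := K - #S) (n := Fintype.card V) hba ha ?_ ?_ ?_ ?_ ?_ ?_ ?_ ?_ ?_ ?_ ?_ ?_
  · rw [Nat.cast_sub hstn, ← hcardT]
    push_cast
    ring
  · exact (div_lt_iff₀ hpaΔ).mp hn
  · rw [mul_sub, hK, mul_div_cancel₀ _ hpab.ne']
  · have h1 : (#S : ℤ) * (a + Δ) ≤ ∑ x ∈ S, f x := by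
      have := Finset.card_nsmul_le_sum S f (a + Δ) fun x _ => by have := hgf x; omega
      simpa using this
    have h2 : ∑ x ∈ T, g x ≤ (#T : ℤ) * (b - Δ) := by
      have := Finset.sum_le_card_nsmul T g (b - Δ) fun x _ => by have := hgf x; omega
      simpa using this
    have h3 : (#S : ℤ) * (a + Δ) + ∑ x ∈ T, (d x : ℤ) + 1 ≤ (#T : ℤ) * (b - Δ) := by linarith
    have h4 : (#S : ℝ) * (a + Δ) + ∑ x ∈ T, (d x : ℝ) + 1 ≤ (#T : ℝ) * (b - Δ) := by
      exact_mod_cast h3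
    rw [← hcardT]
    linarith
  · exact Finset.sum_nonneg fun _ _ => Nat.cast_nonneg _
  · have := sum_incident_card_le H T
    rw [hHm] at this
    exact_mod_cast this
  · have := Finset.sum_le_card_nsmul T _ _ hTd
    rw [nsmul_eq_mul] at this
    rw [← hcardT]
    linarith
  · have := Finset.card_nsmul_le_sum T (fun x => ((a : ℝ) + Δ) * (d x + #S)) ((b : ℝ) * (b - Δ))
      fun x _ => by
        have h1 := hδx x
        have h2 := mul_le_mul_of_nonneg_left (hεm x) hpaΔ.le
        linarith
    rw [← Finset.mul_sum, Finset.sum_add_distrib, Finset.sum_const, nsmul_eq_mul,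
      nsmul_eq_mul] at this
    rw [← hcardT]
    exact this
  · have := Finset.card_nsmul_le_sum T _ _ fun x _ => hδx x
    rw [← Finset.mul_sum, Finset.sum_add_distrib, Finset.sum_add_distrib, Finset.sum_const,
      nsmul_eq_mul, nsmul_eq_mul] at this
    rw [← hcardT]
    exact this
  · exact hsumWZ _ hZdeg
  · intro hk
    rw [← mul_one (#Z : ℝ)]
    refine hsumWZ 1 fun x hx => ?_
    have h1 : (0 : ℝ) < d x + ε x := hk.trans_le (hZdeg x hx)
    have h2 : 0 < d x + ε x := by exact_mod_cast h1
    exact_mod_cast h2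
  · have h1 := Finset.card_nsmul_le_sum Z (fun x => (ε x : ℝ)) (K - #S - (b - Δ) + 1)
      fun x hx => by
        have h1 := hZdeg x hx
        have h2 := hTd x (Finset.mem_filter.mp hx).1
        linarith
    rw [nsmul_eq_mul] at h1
    have h2 : (0 : ℝ) ≤ ∑ x ∈ W, (ε x : ℝ) :=
      Finset.sum_nonneg fun _ _ => Nat.cast_nonneg _
    rw [hsplit]
    linarith
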